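/- Let H be a connected P5-free graph whose vertex set is partitioned into three sets P, Q and {v}, where the vertex v is adjacent to every vertex of Q and adjacent to no vertex of P. Then there exists at most one connected component of the subgraph induced by P that contains two vertices a and b for which there are two distinct connected components Y1 and Y2 of the subgraph induced by Q with: a adjacent to some vertex of Y1 but to no vertex of Y2, and b adjacent to some vertex of Y2 but to no vertex of Y1. Precisely: if X1 and X2 are connected components of the subgraph induced by P each containing such a pair of vertices (with respect to some pair of distinct components of the subgraph induced by Q), then X1 = X2. -/

import Mathlib

/-- A graph is `P₅`-free if it contains no induced subgraph isomorphic to the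
path on five vertices. -/
def P5Free {V : Type*} (G : SimpleGraph V) : Prop :=
  ∀ f : Fin 5 ↪ V, ¬ (∀ i j, G.Adj (f i) (f j) ↔ (SimpleGraph.pathGraph 5).Adj i j)

/-- `Y` is (the vertex set of) a connected component of the subgraph of `G`
induced by `S`. -/
def IsCompOf {V : Type*} (G : SimpleGraph V) (S Y : Set V) : Prop :=
  ∃ u : S, Y = {w : V | ∃ h : w ∈ S, (G.induce S).Reachable ⟨w, h⟩ u}

/-- The component `X` of the subgraph induced by `P` contains two vertices `a`
and `b` together with two distinct components `Y₁ ≠ Y₂` of the subgraph induced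
by `Q` such that `a` is adjacent to `Y₁` but not to `Y₂` while `b` is adjacent
to `Y₂` but not to `Y₁`. -/
def HasCrossingPair {V : Type*} (G : SimpleGraph V) (Q X : Set V) : Prop :=
  ∃ a ∈ X, ∃ b ∈ X, ∃ Y1 Y2 : Set V, IsCompOf G Q Y1 ∧ IsCompOf G Q Y2 ∧ Y1 ≠ Y2 ∧
    (∃ y ∈ Y1, G.Adj a y) ∧ (∀ y ∈ Y2, ¬ G.Adj a y) ∧
    (∃ y ∈ Y2, G.Adj b y) ∧ (∀ y ∈ Y1, ¬ G.Adj b y)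

section Helpers

variable {V : Type*} {G : SimpleGraph V} {S Y Y' : Set V}

/-- Five vertices inducing a path (their distinctness follows from the adjacencies). -/
theorem P5Free.false_of_path (hG : P5Free G) {p q r s t : V}
    (hpq : G.Adj p q) (hqr : G.Adj q r) (hrs : G.Adj r s) (hst : G.Adj s t)
    (hpr : ¬ G.Adj p r) (hps : ¬ G.Adj p s) (hpt : ¬ G.Adj p t)
    (hqs : ¬ G.Adj q s) (hqt : ¬ G.Adj q t) (hrt : ¬ G.Adj r t) : False := by
  have hadj : ∀ i j, G.Adj (![p, q, r, s, t] i) (![p, q, r, s, t] j) ↔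
      (SimpleGraph.pathGraph 5).Adj i j := by
    intro i j
    fin_cases i <;> fin_cases j <;>
      simp [SimpleGraph.pathGraph_adj, G.adj_comm, *]
  refine hG ⟨![p, q, r, s, t], fun i j hij => ?_⟩ hadj
  have hnbr : ∀ k, (SimpleGraph.pathGraph 5).Adj i k ↔ (SimpleGraph.pathGraph 5).Adj j k := by
    intro k
    rw [← hadj, ← hadj, hij]
  simp only [SimpleGraph.pathGraph_adj] at hnbr
  revert hnbr
  clear hij
  revert i j
  decide

theorem IsCompOf.subset (hY : IsCompOf G S Y) : Y ⊆ S := by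
  obtain ⟨u, rfl⟩ := hY
  exact fun _ h => h.1

theorem IsCompOf.mem_of_adj (hY : IsCompOf G S Y) {y z : V} (hy : y ∈ Y) (hz : z ∈ S)
    (h : G.Adj y z) : z ∈ Y := by
  obtain ⟨u, rfl⟩ := hY
  obtain ⟨hyS, hyu⟩ := hy
  have hzy : (G.induce S).Adj ⟨z, hz⟩ ⟨y, hyS⟩ := h.symm
  exact ⟨hz, hzy.reachable.trans hyu⟩

/-- A property that holds somewhere on a component and is preserved along its edges holds
everywhere on it. -/
theorem IsCompOf.induction (hY : IsCompOf G S Y) {p : V → Prop} {y z : V} (hy : y ∈ Y)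
    (hz : z ∈ Y) (hpy : p y) (step : ∀ a ∈ Y, ∀ b ∈ Y, G.Adj a b → p a → p b) : p z := by
  have hyS := hY.subset hy
  have hzS := hY.subset hz
  have hreach : (G.induce S).Reachable ⟨y, hyS⟩ ⟨z, hzS⟩ := by
    obtain ⟨u, rfl⟩ := hY
    exact hy.2.trans hz.2.symm
  rw [SimpleGraph.reachable_iff_reflTransGen] at hreach
  have key : ∀ w : S, Relation.ReflTransGen (G.induce S).Adj ⟨y, hyS⟩ w →
      (w : V) ∈ Y ∧ p w := by
    intro w hw
    induction hw with
    | refl => exact ⟨hy, hpy⟩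
    | @tail b c _ hbc ih =>
      have hc : (c : V) ∈ Y := hY.mem_of_adj ih.1 c.2 hbc
      exact ⟨hc, step b ih.1 c hc hbc ih.2⟩
  exact (key _ hreach).2

theorem IsCompOf.eq_of_mem (hY : IsCompOf G S Y) (hY' : IsCompOf G S Y') {y : V}
    (hy : y ∈ Y) (hy' : y ∈ Y') : Y = Y' := by
  ext z
  exact ⟨fun hz => hY.induction hy hz hy'
      fun a _ b hb hab ha => hY'.mem_of_adj ha (hY.subset hb) hab,
    fun hz => hY'.induction hy' hz hy
      fun a _ b hb hab ha => hY.mem_of_adj ha (hY'.subset hb) hab⟩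

theorem IsCompOf.not_adj_of_ne (hY : IsCompOf G S Y) (hY' : IsCompOf G S Y') (hne : Y ≠ Y')
    {y z : V} (hy : y ∈ Y) (hz : z ∈ Y') : ¬ G.Adj y z := fun h =>
  hne (hY.eq_of_mem hY' (hY.mem_of_adj hy (hY'.subset hz) h) hz)

/-- Two vertices that see different components of `S`, each missing the other's, are adjacent
when some further vertex `v` is complete to `S` and adjacent to neither of them. -/
theorem P5Free.adj_of_crossing (hG : P5Free G) {v a b : V} (hv : ∀ q ∈ S, G.Adj v q)
    (hva : ¬ G.Adj v a) (hvb : ¬ G.Adj v b) (hY : IsCompOf G S Y) (hY' : IsCompOf G S Y')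
    (haY : ∃ y ∈ Y, G.Adj a y) (haY' : ¬ ∃ y ∈ Y', G.Adj a y)
    (hbY' : ∃ y ∈ Y', G.Adj b y) (hbY : ¬ ∃ y ∈ Y, G.Adj b y) : G.Adj a b := by
  by_contra hab
  have hne : Y ≠ Y' := by
    rintro rfl
    exact hbY hbY'
  obtain ⟨y, hy, hay⟩ := haY
  obtain ⟨z, hz, hbz⟩ := hbY'
  exact hG.false_of_path hay (hv y (hY.subset hy)).symm (hv z (hY'.subset hz)) hbz.symm
    (fun h => hva h.symm) (fun h => haY' ⟨z, hz, h⟩) hab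
    (hY.not_adj_of_ne hY' hne hy hz) (fun h => hbY ⟨y, hy, h.symm⟩) hvb

/-- If adjacent vertices `a` and `b` see different components, each missing the other's, then `a`
is complete to the component it sees. -/
theorem P5Free.adj_of_mem_of_crossing (hG : P5Free G) {a b : V} (hab : G.Adj a b)
    (hY : IsCompOf G S Y) (hY' : IsCompOf G S Y')
    (haY : ∃ y ∈ Y, G.Adj a y) (haY' : ¬ ∃ y ∈ Y', G.Adj a y)
    (hbY' : ∃ y ∈ Y', G.Adj b y) (hbY : ¬ ∃ y ∈ Y, G.Adj b y) {y : V} (hy : y ∈ Y) :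
    G.Adj a y := by
  have hne : Y ≠ Y' := by
    rintro rfl
    exact hbY hbY'
  obtain ⟨w, hw, haw⟩ := haY
  obtain ⟨z, hz, hbz⟩ := hbY'
  refine hY.induction (p := G.Adj a) hw hy haw fun s hs t ht hst has => ?_
  by_contra hat
  exact hG.false_of_path hbz.symm hab.symm has hst (fun h => haY' ⟨z, hz, h.symm⟩)
    (fun h => hY.not_adj_of_ne hY' hne hs hz h.symm)
    (fun h => hY.not_adj_of_ne hY' hne ht hz h.symm)
    (fun h => hbY ⟨s, hs, h⟩) (fun h => hbY ⟨t, ht, h⟩) hat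

/-- For an edge `ab` anticomplete to `c`, with `a` complete to `Y` and `b` anticomplete to `Y`,
the vertex `c` cannot see both `Y` and a component `Z` missed by `a` and `b`. -/
theorem P5Free.false_of_common_component (hG : P5Free G) {a b c : V} {Z : Set V}
    (hab : G.Adj a b) (hac : ¬ G.Adj a c) (hbc : ¬ G.Adj b c)
    (hY : IsCompOf G S Y) (hZ : IsCompOf G S Z)
    (haY : ∀ y ∈ Y, G.Adj a y) (hbY : ¬ ∃ y ∈ Y, G.Adj b y) (hcY : ∃ y ∈ Y, G.Adj c y)
    (hcZ : ∃ z ∈ Z, G.Adj c z) (haZ : ¬ ∃ z ∈ Z, G.Adj a z) (hbZ : ¬ ∃ z ∈ Z, G.Adj b z) :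
    False := by
  obtain ⟨y, hy, hcy⟩ := hcY
  obtain ⟨z, hz, hcz⟩ := hcZ
  have hne : Y ≠ Z := by
    rintro rfl
    exact haZ ⟨y, hy, haY y hy⟩
  exact hG.false_of_path hab.symm (haY y hy) hcy.symm hcz (fun h => hbY ⟨y, hy, h⟩) hbc
    (fun h => hbZ ⟨z, hz, h⟩) hac (fun h => haZ ⟨z, hz, h⟩) (hY.not_adj_of_ne hZ hne hy hz)

end Helpers

/-- Theorem 2 of the paper: in a connected `P₅`-free graph whose vertex set is
partitioned into `P`, `Q` and `{v}`, where `v` is adjacent to every vertex of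
`Q` and to no vertex of `P`, at most one component of the subgraph induced by
`P` contains a "crossing pair" of vertices. -/
theorem atMostOne_component_with_crossing_pair
    {V : Type*} (H : SimpleGraph V) (hconn : H.Connected) (hP5 : P5Free H)
    (P Q : Set V) (v : V)
    (hcover : P ∪ Q ∪ {v} = Set.univ) (hPQ : Disjoint P Q)
    (hvP : v ∉ P) (hvQ : v ∉ Q)
    (hvq : ∀ q ∈ Q, H.Adj v q) (hvp : ∀ p ∈ P, ¬ H.Adj v p)
    (X1 X2 : Set V) (hX1 : IsCompOf H P X1) (hX2 : IsCompOf H P X2)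
    (h1 : HasCrossingPair H Q X1) (h2 : HasCrossingPair H Q X2) :
    X1 = X2 := by
  by_contra hne
  obtain ⟨a, ha, b, hb, Y1, Y2, hY1, hY2, -, haY1, haY2, hbY2, hbY1⟩ := h1
  obtain ⟨c, hc, d, hd, Z1, Z2, hZ1, hZ2, -, hcZ1, hcZ2, hdZ2, hdZ1⟩ := h2
  replace haY2 : ¬ ∃ y ∈ Y2, H.Adj a y := by simpa using haY2
  replace hbY1 : ¬ ∃ y ∈ Y1, H.Adj b y := by simpa using hbY1
  replace hcZ2 : ¬ ∃ y ∈ Z2, H.Adj c y := by simpa using hcZ2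
  replace hdZ1 : ¬ ∃ y ∈ Z1, H.Adj d y := by simpa using hdZ1
  have hv1 : ∀ x ∈ X1, ¬ H.Adj v x := fun x hx => hvp x (hX1.subset hx)
  have hv2 : ∀ x ∈ X2, ¬ H.Adj v x := fun x hx => hvp x (hX2.subset hx)
  have hX : ∀ x ∈ X1, ∀ z ∈ X2, ¬ H.Adj x z := fun x hx z hz =>
    hX1.not_adj_of_ne hX2 hne hx hz
  have hab := hP5.adj_of_crossing hvq (hv1 a ha) (hv1 b hb) hY1 hY2 haY1 haY2 hbY2 hbY1
  have hcd := hP5.adj_of_crossing hvq (hv2 c hc) (hv2 d hd) hZ1 hZ2 hcZ1 hcZ2 hdZ2 hdZ1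
  have comparable : ∀ x ∈ X1, ∀ z ∈ X2, ∀ Y Z : Set V, IsCompOf H Q Y → IsCompOf H Q Z →
      (∃ y ∈ Y, H.Adj x y) → (∃ y ∈ Z, H.Adj z y) →
      (∃ y ∈ Z, H.Adj x y) ∨ (∃ y ∈ Y, H.Adj z y) := by
    intro x hx z hz Y Z hY hZ hxY hzZ
    by_contra! h
    refine hX x hx z hz (hP5.adj_of_crossing hvq (hv1 x hx) (hv2 z hz) hY hZ hxY ?_ hzZ ?_)
    · simpa using h.1
    · simpa using h.2
  have case1 := hP5.false_of_common_component hab (hX a ha c hc) (hX b hb c hc) hY1 hZ1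
    (fun y hy => hP5.adj_of_mem_of_crossing hab hY1 hY2 haY1 haY2 hbY2 hbY1 hy) hbY1
  have case2 := hP5.false_of_common_component hcd (fun h => hX a ha c hc h.symm)
    (fun h => hX a ha d hd h.symm) hZ1 hY1
    (fun y hy => hP5.adj_of_mem_of_crossing hcd hZ1 hZ2 hcZ1 hcZ2 hdZ2 hdZ1 hy) hdZ1
  have hac := comparable a ha c hc
  have had := comparable a ha d hd
  have hbc := comparable b hb c hc
  have hbd := comparable b hb d hd
  by_cases haZ1 : ∃ y ∈ Z1, H.Adj a y
  · have haZ2 := (had Z1 Z2 hZ1 hZ2 haZ1 hdZ2).resolve_right hdZ1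
    have hcY2 : ¬ ∃ y ∈ Y2, H.Adj c y := fun h => (hac Z2 Y2 hZ2 hY2 haZ2 h).elim haY2 hcZ2
    have hdY2 : ¬ ∃ y ∈ Y2, H.Adj d y := fun h => (had Z1 Y2 hZ1 hY2 haZ1 h).elim haY2 hdZ1
    exact case2 haZ1 haY1 (fun h => (hbc Y2 Y1 hY2 hY1 hbY2 h).elim hbY1 hcY2)
      (fun h => (hbd Y2 Y1 hY2 hY1 hbY2 h).elim hbY1 hdY2)
  · have hcY1 := (hac Y1 Z1 hY1 hZ1 haY1 hcZ1).resolve_left haZ1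
    refine case1 hcY1 hcZ1 haZ1 fun hbZ1 => ?_
    have hbZ2 := (hbd Z1 Z2 hZ1 hZ2 hbZ1 hdZ2).resolve_right hdZ1
    exact (hbc Z2 Y1 hZ2 hY1 hbZ2 hcY1).elim hbY1 hcZ2
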